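/- arXiv:2501.08950 — 3 statements merged into one kernel-verified Lean document; each statement's English description precedes it below -/
import Mathlib

section
/- Every Mann-Kleene scheme is exact: if (α_n), (β_n) are sequences in [0,1) with lim β_n = 0, Σ_n β_n = ∞ and lim α_n = 0, then for every d ∈ ℕ, every closed convex set X ⊆ ℝ^d of vectors with non-negative entries containing 0, every monotone non-expansive f : X → X with at least one fixpoint, and every x_0 ∈ X, the dampened Mann iteration with the constant function sequence f_n = f converges to the least fixpoint μf of f. -/
open Filter Set Topology

/-- The dampened Mann iteration:
`x₀ = x0`, `x_{n+1} = (1 - β n) • (α n • x n + (1 - α n) • f n (x n))`. -/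
noncomputable def mannSeq {E : Type*} [AddCommGroup E] [Module ℝ E]
    (α β : ℕ → ℝ) (f : ℕ → E → E) (x0 : E) : ℕ → E
  | 0 => x0
  | n + 1 => (1 - β n) • (α n • mannSeq α β f x0 n + (1 - α n) • f n (mannSeq α β f x0 n))

/-- One dampened Mann step stays in a convex set containing `0`. -/
theorem mann_step_mem {E : Type*} [AddCommGroup E] [Module ℝ E] {X : Set E} {a b : ℝ}
    (ha : a ∈ Ico (0 : ℝ) 1) (hb : b ∈ Ico (0 : ℝ) 1) (hXc : Convex ℝ X) (h0 : (0 : E) ∈ X)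
    {x y : E} (hx : x ∈ X) (hy : y ∈ X) : (1 - b) • (a • x + (1 - a) • y) ∈ X :=
  hXc.smul_mem_of_zero_mem h0
    (hXc hx hy ha.1 (by linarith [ha.2]) (by ring)) ⟨by linarith [hb.2], by linarith [hb.1]⟩

theorem mannSeq_mem {E : Type*} [AddCommGroup E] [Module ℝ E] {X : Set E} {α β : ℕ → ℝ}
    (hα : ∀ n, α n ∈ Ico (0 : ℝ) 1) (hβ : ∀ n, β n ∈ Ico (0 : ℝ) 1)
    (hXc : Convex ℝ X) (h0 : (0 : E) ∈ X) {f : E → E} (hmap : MapsTo f X X)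
    {x : E} (hx : x ∈ X) (n : ℕ) : mannSeq α β (fun _ => f) x n ∈ X := by
  induction n with
  | zero => exact hx
  | succ n ih => exact mann_step_mem (hα n) (hβ n) hXc h0 ih (hmap ih)

/-- Two dampened Mann iterations of a non-expansive map approach each other. -/
theorem norm_mannSeq_sub_le {E : Type*} [NormedAddCommGroup E] [NormedSpace ℝ E] {X : Set E}
    {α β : ℕ → ℝ} (hα : ∀ n, α n ∈ Ico (0 : ℝ) 1) (hβ : ∀ n, β n ∈ Ico (0 : ℝ) 1)
    (hXc : Convex ℝ X) (h0 : (0 : E) ∈ X) {f : E → E} (hmap : MapsTo f X X)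
    (hne : LipschitzOnWith 1 f X) {x y : E} (hx : x ∈ X) (hy : y ∈ X) (n : ℕ) :
    ‖mannSeq α β (fun _ => f) x n - mannSeq α β (fun _ => f) y n‖
      ≤ Real.exp (-∑ i ∈ Finset.range n, β i) * ‖x - y‖ := by
  induction n with
  | zero => simp [mannSeq]
  | succ n ih =>
    have hu := mannSeq_mem hα hβ hXc h0 hmap hx n
    have hv := mannSeq_mem hα hβ hXc h0 hmap hy n
    simp only [mannSeq]
    set u := mannSeq α β (fun _ => f) x n
    set v := mannSeq α β (fun _ => f) y n
    have ha := hα n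
    have hb := hβ n
    have hf : ‖f u - f v‖ ≤ ‖u - v‖ := by simpa using hne.norm_sub_le hu hv
    have hsplit : (1 - β n) • (α n • u + (1 - α n) • f u)
        - (1 - β n) • (α n • v + (1 - α n) • f v)
        = (1 - β n) • (α n • (u - v) + (1 - α n) • (f u - f v)) := by module
    have hstep : ‖α n • (u - v) + (1 - α n) • (f u - f v)‖ ≤ ‖u - v‖ := by
      refine (norm_add_le _ _).trans ?_
      rw [norm_smul, norm_smul, Real.norm_of_nonneg ha.1,
        Real.norm_of_nonneg (by linarith [ha.2] : (0 : ℝ) ≤ 1 - α n)]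
      nlinarith [ha.2]
    rw [hsplit, norm_smul, Real.norm_of_nonneg (by linarith [hb.2] : (0 : ℝ) ≤ 1 - β n),
      Finset.sum_range_succ, neg_add, Real.exp_add, mul_comm (Real.exp _) (Real.exp (-β n)),
      mul_assoc]
    exact mul_le_mul (Real.one_sub_le_exp_neg _) (hstep.trans ih) (norm_nonneg _)
      (Real.exp_pos _).le

theorem tendsto_mannSeq_sub {E : Type*} [NormedAddCommGroup E] [NormedSpace ℝ E] {X : Set E}
    {α β : ℕ → ℝ} (hα : ∀ n, α n ∈ Ico (0 : ℝ) 1) (hβ : ∀ n, β n ∈ Ico (0 : ℝ) 1)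
    (hβdiv : ¬ Summable β)
    (hXc : Convex ℝ X) (h0 : (0 : E) ∈ X) {f : E → E} (hmap : MapsTo f X X)
    (hne : LipschitzOnWith 1 f X) {x y : E} (hx : x ∈ X) (hy : y ∈ X) :
    Tendsto (fun n => mannSeq α β (fun _ => f) x n - mannSeq α β (fun _ => f) y n)
      atTop (𝓝 0) := by
  have hsum := (not_summable_iff_tendsto_nat_atTop_of_nonneg fun n => (hβ n).1).1 hβdiv
  have hexp := (Real.tendsto_exp_neg_atTop_nhds_zero.comp hsum).mul_const ‖x - y‖
  rw [zero_mul] at hexp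
  exact squeeze_zero_norm (norm_mannSeq_sub_le hα hβ hXc h0 hmap hne hx hy) hexp

/-- A fixed number of dampened Mann steps, started from `x` at time `N`, approximates the
iterates of `f` as `N → ∞`. -/
theorem tendsto_mannSeq_shift {E : Type*} [AddCommGroup E] [Module ℝ E] [TopologicalSpace E]
    [ContinuousAdd E] [ContinuousSMul ℝ E] {X : Set E}
    {α β : ℕ → ℝ} (hα : ∀ n, α n ∈ Ico (0 : ℝ) 1) (hβ : ∀ n, β n ∈ Ico (0 : ℝ) 1)
    (hα0 : Tendsto α atTop (𝓝 0)) (hβ0 : Tendsto β atTop (𝓝 0))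
    (hXc : Convex ℝ X) (h0 : (0 : E) ∈ X) {f : E → E} (hmap : MapsTo f X X)
    (hf : ContinuousOn f X) {x : E} (hx : x ∈ X) (k : ℕ) :
    Tendsto (fun N => mannSeq (fun n => α (N + n)) (fun n => β (N + n)) (fun _ => f) x k)
      atTop (𝓝 (f^[k] x)) := by
  induction k with
  | zero => exact tendsto_const_nhds
  | succ k ih =>
    have hfy := (hf _ (hmap.iterate k hx)).tendsto.comp
      (tendsto_nhdsWithin_iff.2 ⟨ih, Eventually.of_forall fun N =>
        mannSeq_mem (fun n => hα (N + n)) (fun n => hβ (N + n)) hXc h0 hmap hx k⟩)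
    have ha := hα0.comp (tendsto_add_atTop_nat k)
    have hb := hβ0.comp (tendsto_add_atTop_nat k)
    have h := (hb.const_sub 1).smul ((ha.smul ih).add ((ha.const_sub 1).smul hfy))
    rw [Function.iterate_succ_apply']
    simpa [mannSeq, Function.comp_def] using h

section Order

variable {d : ℕ} {X : Set (Fin d → ℝ)} {f : (Fin d → ℝ) → (Fin d → ℝ)}

theorem mannSeq_shift_zero_le {α β : ℕ → ℝ}
    (hα : ∀ n, α n ∈ Ico (0 : ℝ) 1) (hβ : ∀ n, β n ∈ Ico (0 : ℝ) 1)
    (hXc : Convex ℝ X) (hpos : ∀ x ∈ X, ∀ i, 0 ≤ x i) (h0 : (0 : Fin d → ℝ) ∈ X)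
    (hmap : MapsTo f X X) (hmono : MonotoneOn f X) {x : Fin d → ℝ} (hx : x ∈ X) (N k : ℕ) :
    mannSeq (fun n => α (N + n)) (fun n => β (N + n)) (fun _ => f) 0 k
      ≤ mannSeq α β (fun _ => f) x (N + k) := by
  induction k with
  | zero => exact hpos _ (mannSeq_mem hα hβ hXc h0 hmap hx N)
  | succ k ih =>
    have hu := mannSeq_mem (fun n => hα (N + n)) (fun n => hβ (N + n)) hXc h0 hmap h0 k
    have hv := mannSeq_mem hα hβ hXc h0 hmap hx (N + k)
    have ha := hα (N + k)
    have hb := hβ (N + k)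
    exact smul_le_smul_of_nonneg_left
      (add_le_add (smul_le_smul_of_nonneg_left ih ha.1)
        (smul_le_smul_of_nonneg_left (hmono hu hv ih) (by linarith [ha.2])))
      (by linarith [hb.2])

theorem mannSeq_zero_le_fixedPoint {α β : ℕ → ℝ}
    (hα : ∀ n, α n ∈ Ico (0 : ℝ) 1) (hβ : ∀ n, β n ∈ Ico (0 : ℝ) 1)
    (hXc : Convex ℝ X) (hpos : ∀ x ∈ X, ∀ i, 0 ≤ x i) (h0 : (0 : Fin d → ℝ) ∈ X)
    (hmap : MapsTo f X X) (hmono : MonotoneOn f X) {p : Fin d → ℝ} (hp : p ∈ X)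
    (hfp : f p = p) (n : ℕ) : mannSeq α β (fun _ => f) 0 n ≤ p := by
  induction n with
  | zero => exact hpos p hp
  | succ n ih =>
    have hu := mannSeq_mem hα hβ hXc h0 hmap h0 n
    have ha := hα n
    have hb := hβ n
    intro i
    have h1 := ih i
    have h2 := hmono hu hp ih i
    have h3 := hpos p hp i
    rw [hfp] at h2
    simp only [mannSeq, Pi.smul_apply, Pi.add_apply, smul_eq_mul]
    set u := mannSeq α β (fun _ => f) 0 n
    have h4 : α n * u i + (1 - α n) * f u i ≤ p i := by nlinarith [ha.1, ha.2]
    nlinarith [hb.1, hb.2]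

/-- Kleene iteration of a monotone continuous map from `0` converges to the least fixpoint. -/
theorem tendsto_iterate_zero_leastFixedPoint (hX : IsClosed X)
    (hpos : ∀ x ∈ X, ∀ i, 0 ≤ x i) (h0 : (0 : Fin d → ℝ) ∈ X)
    (hmap : MapsTo f X X) (hmono : MonotoneOn f X) (hf : ContinuousOn f X)
    {p : Fin d → ℝ} (hp : IsLeast {x | x ∈ X ∧ f x = x} p) :
    Tendsto (fun k => f^[k] 0) atTop (𝓝 p) := by
  have hmem : ∀ k, f^[k] 0 ∈ X := fun k => hmap.iterate k h0
  have hle : ∀ k, f^[k] 0 ≤ p := by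
    intro k
    induction k with
    | zero => exact hpos p hp.1.1
    | succ k ih =>
      rw [Function.iterate_succ_apply', ← hp.1.2]
      exact hmono (hmem k) hp.1.1 ih
  have hinc : Monotone fun k => f^[k] 0 := by
    refine monotone_nat_of_le_succ fun k => ?_
    induction k with
    | zero => exact hpos _ (hmem 1)
    | succ k ih =>
      rw [Function.iterate_succ_apply', Function.iterate_succ_apply' f (k + 1)]
      exact hmono (hmem k) (hmem (k + 1)) ih
  have hlim := tendsto_atTop_ciSup hinc ⟨p, forall_mem_range.2 hle⟩
  set L := ⨆ k, f^[k] 0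
  have hLX : L ∈ X := hX.mem_of_tendsto hlim (Eventually.of_forall hmem)
  have hfL : f L = L := by
    have h1 := (hf L hLX).tendsto.comp
      (tendsto_nhdsWithin_iff.2 ⟨hlim, Eventually.of_forall hmem⟩)
    have h2 := hlim.comp (tendsto_add_atTop_nat 1)
    refine tendsto_nhds_unique h1 (h2.congr fun k => ?_)
    exact Function.iterate_succ_apply' f k 0
  have hLp : L = p := le_antisymm (le_of_tendsto' hlim hle) (hp.2 ⟨hLX, hfL⟩)
  rwa [hLp] at hlim

end Order

/-- every Mann-Kleene scheme (`α n, β n ∈ [0,1)`, `β n → 0`,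
`Σ β n = ∞`, `α n → 0`) is exact: the dampened Mann iteration with the constant
function sequence `f` converges to the least fixpoint of `f` from every
starting point, for every monotone non-expansive `f` with a fixpoint. -/
theorem mannKleene_exact
    (α β : ℕ → ℝ) (hα : ∀ n, α n ∈ Set.Ico (0 : ℝ) 1) (hβ : ∀ n, β n ∈ Set.Ico (0 : ℝ) 1)
    (hβ0 : Tendsto β atTop (nhds 0)) (hβdiv : ¬ Summable β)
    (hα0 : Tendsto α atTop (nhds 0))
    (d : ℕ) (X : Set (Fin d → ℝ)) (hX : IsClosed X) (hXc : Convex ℝ X)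
    (hpos : ∀ x ∈ X, ∀ i, 0 ≤ x i) (h0 : (0 : Fin d → ℝ) ∈ X)
    (f : (Fin d → ℝ) → (Fin d → ℝ)) (hmap : Set.MapsTo f X X)
    (hmono : ∀ x ∈ X, ∀ y ∈ X, x ≤ y → f x ≤ f y)
    (hne : LipschitzOnWith 1 f X)
    (hfix : ∃ x ∈ X, f x = x)
    (μ : Fin d → ℝ) (hμ : IsLeast {x | x ∈ X ∧ f x = x} μ)
    (x0 : Fin d → ℝ) (hx0 : x0 ∈ X) :
    Tendsto (mannSeq α β (fun _ => f) x0) atTop (nhds μ) := by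
  have hmonoOn : MonotoneOn f X := fun x hx y hy h => hmono x hx y hy h
  have hzero : Tendsto (mannSeq α β (fun _ => f) 0) atTop (𝓝 μ) := by
    refine tendsto_pi_nhds.2 fun i => tendsto_order.2 ⟨fun c hc => ?_, fun c hc => ?_⟩
    · have hkleene := tendsto_pi_nhds.1 (tendsto_iterate_zero_leastFixedPoint hX hpos h0 hmap
        hmonoOn hne.continuousOn hμ) i
      obtain ⟨k, hk⟩ := (hkleene.eventually (lt_mem_nhds hc)).exists
      have hshift := tendsto_pi_nhds.1 (tendsto_mannSeq_shift hα hβ hα0 hβ0 hXc h0 hmap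
        hne.continuousOn h0 k) i
      obtain ⟨M, hM⟩ := eventually_atTop.1 (hshift.eventually (lt_mem_nhds hk))
      filter_upwards [eventually_ge_atTop (M + k)] with n hn
      obtain ⟨N, rfl⟩ := Nat.exists_eq_add_of_le' (le_of_add_le_right hn)
      exact (hM N (by omega)).trans_le
        (mannSeq_shift_zero_le hα hβ hXc hpos h0 hmap hmonoOn h0 N k i)
    · exact Eventually.of_forall fun n => (mannSeq_zero_le_fixedPoint hα hβ hXc hpos h0 hmap
        hmonoOn hμ.1.1 hμ.1.2 n i).trans_lt hc
  simpa using (tendsto_mannSeq_sub hα hβ hβdiv hXc h0 hmap hne hx0 h0).add hzero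
end

section
/- Let S be a finite set, let h : ℝ≥0^S → ℝ≥0^S be monotone and witness-bounded with witness u : ℝ≥0^S → ℝ≥0^S, and let k ∈ ℕ and 0 ≤ c < 1 be such that ‖u^k(v)‖ ≤ c·‖v‖ for all v ∈ ℝ≥0^S. Then h has a least fixpoint μh, and ‖μh‖ ≤ ‖h^k(0)‖/(1−c). -/
open Filter Set Topology

/-- If `|h v - h w| ≤ u |v - w|` on the non-negative orthant, for monotone `u`, then
`|h^[n] v - h^[n] w| ≤ u^[n] |v - w|` there. -/
theorem abs_iterate_sub_iterate_le {S : Type*} {h u : (S → ℝ) → (S → ℝ)}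
    (hmaph : Set.MapsTo h {v : S → ℝ | ∀ s, 0 ≤ v s} {v : S → ℝ | ∀ s, 0 ≤ v s})
    (hmapu : Set.MapsTo u {v : S → ℝ | ∀ s, 0 ≤ v s} {v : S → ℝ | ∀ s, 0 ≤ v s})
    (humono : ∀ v ∈ {v : S → ℝ | ∀ s, 0 ≤ v s}, ∀ w ∈ {v : S → ℝ | ∀ s, 0 ≤ v s},
      v ≤ w → u v ≤ u w)
    (hhb : ∀ v ∈ {v : S → ℝ | ∀ s, 0 ≤ v s}, ∀ w ∈ {v : S → ℝ | ∀ s, 0 ≤ v s},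
      ∀ s, |h v s - h w s| ≤ u (fun t => |v t - w t|) s)
    {v w : S → ℝ} (hv : ∀ s, 0 ≤ v s) (hw : ∀ s, 0 ≤ w s) (n : ℕ) (s : S) :
    |h^[n] v s - h^[n] w s| ≤ u^[n] (fun t => |v t - w t|) s := by
  induction n generalizing s with
  | zero => exact le_rfl
  | succ n ih =>
    rw [Function.iterate_succ_apply', Function.iterate_succ_apply',
      Function.iterate_succ_apply']
    exact (hhb _ (hmaph.iterate n hv) _ (hmaph.iterate n hw) s).trans
      (humono _ (fun t => abs_nonneg _) _ (hmapu.iterate n fun t => abs_nonneg _) ih s)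

/-- a monotone witness-bounded function `h` (with witness `u`
satisfying `‖u^[k] v‖ ≤ c ‖v‖`, `0 ≤ c < 1`) on the non-negative orthant has a
least fixpoint `μh`, and `‖μh‖ ≤ ‖h^[k] 0‖ / (1-c)`. -/
theorem witness_bounded_least_fixpoint
    (S : Type) [Fintype S]
    (h u : (S → ℝ) → (S → ℝ))
    (hmaph : Set.MapsTo h {v : S → ℝ | ∀ s, 0 ≤ v s} {v : S → ℝ | ∀ s, 0 ≤ v s})
    (hmapu : Set.MapsTo u {v : S → ℝ | ∀ s, 0 ≤ v s} {v : S → ℝ | ∀ s, 0 ≤ v s})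
    (hhmono : ∀ v ∈ {v : S → ℝ | ∀ s, 0 ≤ v s}, ∀ w ∈ {v : S → ℝ | ∀ s, 0 ≤ v s},
      v ≤ w → h v ≤ h w)
    (humono : ∀ v ∈ {v : S → ℝ | ∀ s, 0 ≤ v s}, ∀ w ∈ {v : S → ℝ | ∀ s, 0 ≤ v s},
      v ≤ w → u v ≤ u w)
    (huwit : ∀ v ∈ {v : S → ℝ | ∀ s, 0 ≤ v s}, ∀ w ∈ {v : S → ℝ | ∀ s, 0 ≤ v s},
      ∀ s, |u v s - u w s| ≤ u (fun t => |v t - w t|) s)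
    (k : ℕ) (c : ℝ) (hc0 : 0 ≤ c) (hc1 : c < 1)
    (hpow : ∀ v ∈ {v : S → ℝ | ∀ s, 0 ≤ v s}, ‖u^[k] v‖ ≤ c * ‖v‖)
    (hhb : ∀ v ∈ {v : S → ℝ | ∀ s, 0 ≤ v s}, ∀ w ∈ {v : S → ℝ | ∀ s, 0 ≤ v s},
      ∀ s, |h v s - h w s| ≤ u (fun t => |v t - w t|) s) :
    ∃ μ : S → ℝ, IsLeast {v | (∀ s, 0 ≤ v s) ∧ h v = v} μ ∧
      ‖μ‖ ≤ ‖h^[k] 0‖ / (1 - c) := by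
  set P : Set (S → ℝ) := {v : S → ℝ | ∀ s, 0 ≤ v s} with hP
  have hclosed : IsClosed P := by
    simp only [hP, Set.ofPred_forall]
    exact isClosed_iInter fun s => isClosed_le continuous_const (continuous_apply s)
  have : CompleteSpace P := hclosed.completeSpace_coe
  have hzero : (0 : S → ℝ) ∈ P := fun s => le_rfl
  have : Nonempty P := ⟨⟨0, hzero⟩⟩
  let H : P → P := hmaph.restrict h P P
  have hHk (n : ℕ) (v : P) : (H^[n] v : S → ℝ) = h^[n] v := by
    rw [hmaph.iterate_restrict n]; rfl
  have hcontr : ContractingWith ⟨c, hc0⟩ H^[k] := by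
    refine ⟨hc1, LipschitzWith.of_dist_le_mul fun v w => ?_⟩
    have habs : (fun t => |v.1 t - w.1 t|) ∈ P := fun t => abs_nonneg _
    have hnorm : ‖fun t => |v.1 t - w.1 t|‖ ≤ ‖v.1 - w.1‖ :=
      (pi_norm_le_iff_of_nonneg (norm_nonneg _)).2 fun t => by
        simpa using norm_le_pi_norm (v.1 - w.1) t
    have hbound : ‖h^[k] v.1 - h^[k] w.1‖ ≤ ‖u^[k] fun t => |v.1 t - w.1 t|‖ :=
      (pi_norm_le_iff_of_nonneg (norm_nonneg _)).2 fun t =>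
        ((abs_iterate_sub_iterate_le hmaph hmapu humono hhb v.2 w.2 k t).trans
          (le_abs_self _)).trans (norm_le_pi_norm (u^[k] fun t => |v.1 t - w.1 t|) t)
    rw [Subtype.dist_eq, Subtype.dist_eq, hHk, hHk, dist_eq_norm, dist_eq_norm]
    exact (hbound.trans (hpow _ habs)).trans (mul_le_mul_of_nonneg_left hnorm hc0)
  refine ⟨hcontr.fixedPoint, ⟨⟨hcontr.fixedPoint.2, ?_⟩, ?_⟩, ?_⟩
  · exact congrArg Subtype.val hcontr.isFixedPt_fixedPoint_iterate
  · rintro v ⟨hv, hfix⟩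
    have hHv : Function.IsFixedPt H ⟨v, hv⟩ := Subtype.ext hfix
    exact (congrArg Subtype.val (hcontr.fixedPoint_unique (hHv.iterate k))).ge
  · have hdist := hcontr.dist_fixedPoint_le ⟨0, hzero⟩
    rw [Subtype.dist_eq, Subtype.dist_eq, hHk, dist_zero_left, dist_zero_left] at hdist
    exact hdist
end

section
/- Let M = (S, A, T, R) be an MDP with finite value and let (M_n) with M_n = (S, A, T_n, R) be a sequence of MDPs over the same states, actions and rewards such that T_n converges pointwise to T and, for all n, s, a, s', T(s,a,s') = 0 implies T_n(s,a,s') = 0, and Σ_{s'} T_n(s,a,s') = Σ_{s'} T(s,a,s') for all s, a. Let f_n be the Bellman operator of M_n, let (α_n), (β_n) be sequences in [0,1) with lim β_n = 0 and Σ_n β_n = ∞, and let v_0 ∈ ℝ≥0^S. Then the dampened Mann iteration v_{n+1} = (1−β_n)·(α_n·v_n + (1−α_n)·f_n(v_n)) is bounded. -/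
open Filter Set Topology

/-- A Markov decision process with state space `S` and action space `A`:
transition probabilities `T s a s' ∈ [0,1]` with `Σ_{s'} T s a s' ∈ {0,1}` and
non-negative rewards `R`. -/
structure MDP (S A : Type) [Fintype S] [Fintype A] where
  T : S → A → S → ℝ
  R : S → A → S → ℝ
  T_nonneg : ∀ s a s', 0 ≤ T s a s'
  T_le_one : ∀ s a s', T s a s' ≤ 1
  T_sum : ∀ s a, (∑ s', T s a s') = 0 ∨ (∑ s', T s a s') = 1
  R_nonneg : ∀ s a s', 0 ≤ R s a s'

variable {S A : Type} [Fintype S] [Fintype A]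

/-- Action `a` is enabled in state `s`. -/
def MDP.enabled (M : MDP S A) (s : S) (a : A) : Prop :=
  (∑ s', M.T s a s') = 1

/-- The state-value Bellman operator
`f_M(v)(s) = max_{a ∈ A(s)} Σ_{s'} T(s,a,s') (R(s,a,s') + v(s'))`,
with the maximum over the empty set taken to be `0`. -/
noncomputable def MDP.bellman (M : MDP S A) (v : S → ℝ) : S → ℝ :=
  fun s => sSup (insert 0
    {x : ℝ | ∃ a, M.enabled s a ∧ x = ∑ s', M.T s a s' * (M.R s a s' + v s')})

/-- One step inside a candidate end-component: from `t` (in `S'`) one can move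
to `t'` with positive probability using an action from `A' t`. -/
def MDP.ecStep (M : MDP S A) (S' : Set S) (A' : S → Set A) (t t' : S) : Prop :=
  t ∈ S' ∧ ∃ a ∈ A' t, 0 < M.T t a t'

/-- `(S', A')` is an end-component of `M`. -/
def MDP.IsEndComponent (M : MDP S A) (S' : Set S) (A' : S → Set A) : Prop :=
  S'.Nonempty ∧
  (∀ s ∈ S', (A' s).Nonempty ∧ ∀ a ∈ A' s, M.enabled s a) ∧
  (∀ s ∉ S', A' s = ∅) ∧
  (∀ s ∈ S', ∀ a ∈ A' s, ∀ s', 0 < M.T s a s' → s' ∈ S') ∧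
  (∀ s ∈ S', ∀ s' ∈ S', Relation.ReflTransGen (M.ecStep S' A') s s')

/-- `(S', A')` is a maximal end-component of `M` (no strictly larger
end-component under pointwise inclusion exists). -/
def MDP.IsMaximalEC (M : MDP S A) (S' : Set S) (A' : S → Set A) : Prop :=
  M.IsEndComponent S' A' ∧
  ∀ S'' A'', M.IsEndComponent S'' A'' → S' ⊆ S'' → (∀ s, A' s ⊆ A'' s) →
    S'' = S' ∧ ∀ s, A'' s = A' s

namespace MDP

lemma finite_bellman_set (M : MDP S A) (v : S → ℝ) (s : S) :
    (insert 0 {x : ℝ | ∃ a, M.enabled s a ∧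
      x = ∑ s', M.T s a s' * (M.R s a s' + v s')}).Finite := by
  refine Set.Finite.insert _ ((Set.finite_range
    fun a => ∑ s', M.T s a s' * (M.R s a s' + v s')).subset ?_)
  rintro x ⟨a, -, rfl⟩
  exact ⟨a, rfl⟩

lemma bellman_nonneg (M : MDP S A) (v : S → ℝ) (s : S) : 0 ≤ M.bellman v s :=
  le_csSup (M.finite_bellman_set v s).bddAbove (Set.mem_insert _ _)

lemma le_bellman (M : MDP S A) (v : S → ℝ) {s : S} {a : A} (h : M.enabled s a) :
    ∑ s', M.T s a s' * (M.R s a s' + v s') ≤ M.bellman v s :=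
  le_csSup (M.finite_bellman_set v s).bddAbove (Set.mem_insert_of_mem _ ⟨a, h, rfl⟩)

lemma bellman_le (M : MDP S A) {v : S → ℝ} {s : S} {b : ℝ} (hb : 0 ≤ b)
    (h : ∀ a, M.enabled s a → ∑ s', M.T s a s' * (M.R s a s' + v s') ≤ b) :
    M.bellman v s ≤ b := by
  refine csSup_le (Set.insert_nonempty _ _) ?_
  rintro x (rfl | ⟨a, ha, rfl⟩)
  · exact hb
  · exact h a ha

/-- Nonnegative functions that no enabled action increases in expectation. -/
def IsSuperharmonic (M : MDP S A) (w : S → ℝ) : Prop :=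
  (∀ s, 0 ≤ w s) ∧ ∀ s a, M.enabled s a → ∑ s', M.T s a s' * w s' ≤ w s

lemma isSuperharmonic_zero (M : MDP S A) : M.IsSuperharmonic 0 := by
  simp [IsSuperharmonic]

lemma IsSuperharmonic.sum {M : MDP S A} {ι : Type*} [Fintype ι] {w : ι → S → ℝ}
    (h : ∀ i, M.IsSuperharmonic (w i)) : M.IsSuperharmonic (fun s => ∑ i, w i s) := by
  refine ⟨fun s => Finset.sum_nonneg fun i _ => (h i).1 s, fun s a ha => ?_⟩
  simp_rw [Finset.mul_sum]
  rw [Finset.sum_comm]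
  exact Finset.sum_le_sum fun i _ => (h i).2 s a ha

lemma IsSuperharmonic.add_one {M : MDP S A} {w : S → ℝ} (h : M.IsSuperharmonic w) :
    M.IsSuperharmonic (fun s => w s + 1) := by
  refine ⟨fun s => add_nonneg (h.1 s) zero_le_one, fun s a ha => ?_⟩
  have hsum : ∑ s', M.T s a s' = 1 := ha
  simp only [mul_add, mul_one, Finset.sum_add_distrib, hsum]
  linarith [h.2 s a ha]

lemma IsSuperharmonic.min_const {M : MDP S A} {w : S → ℝ} (h : M.IsSuperharmonic w) {c : ℝ}
    (hc : 0 ≤ c) : M.IsSuperharmonic (fun s => min (w s) c) := by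
  refine ⟨fun s => le_min (h.1 s) hc, fun s a ha => le_min ?_ ?_⟩
  · refine (Finset.sum_le_sum fun s' _ => ?_).trans (h.2 s a ha)
    exact mul_le_mul_of_nonneg_left (min_le_left _ _) (M.T_nonneg s a s')
  · have hsum : ∑ s', M.T s a s' = 1 := ha
    calc ∑ s', M.T s a s' * min (w s') c ≤ ∑ s', M.T s a s' * c :=
          Finset.sum_le_sum fun s' _ =>
            mul_le_mul_of_nonneg_left (min_le_right _ _) (M.T_nonneg s a s')
      _ = c := by rw [← Finset.sum_mul, hsum, one_mul]

lemma isSuperharmonic_of_bellman_eq (M : MDP S A) {v : S → ℝ} (hv : ∀ s, 0 ≤ v s)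
    (h : M.bellman v = v) : M.IsSuperharmonic v := by
  refine ⟨hv, fun s a ha => le_trans ?_ ((M.le_bellman v ha).trans_eq (congrFun h s))⟩
  exact Finset.sum_le_sum fun s' _ => mul_le_mul_of_nonneg_left
    (le_add_of_nonneg_left (M.R_nonneg s a s')) (M.T_nonneg s a s')

/-- All superharmonic functions are harmonic at the state-action pair `(s, a)`. -/
def IsTight (M : MDP S A) (s : S) (a : A) : Prop :=
  M.enabled s a ∧ ∀ w, M.IsSuperharmonic w → ∑ s', M.T s a s' * w s' = w s

/-- A superharmonic function is constant on the support of a tight action, since its truncation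
at the value of the current state is superharmonic too. -/
lemma IsTight.eq_of_ne_zero {M : MDP S A} {s : S} {a : A} (h : M.IsTight s a) {w : S → ℝ}
    (hw : M.IsSuperharmonic w) {s' : S} (hT : M.T s a s' ≠ 0) : w s' = w s := by
  have hdiff : ∑ t, M.T s a t * (w t - min (w t) (w s)) = 0 := by
    simp_rw [mul_sub]
    rw [Finset.sum_sub_distrib, h.2 w hw, h.2 _ (hw.min_const (hw.1 s))]
    simp
  have hsum : ∑ t, M.T s a t = 1 := h.1
  have hle : ∀ t, M.T s a t ≠ 0 → w t ≤ w s := fun t ht => by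
    have := (Finset.sum_eq_zero_iff_of_nonneg fun t _ => mul_nonneg (M.T_nonneg s a t)
      (sub_nonneg.2 (min_le_left _ _))).1 hdiff t (Finset.mem_univ t)
    have := (mul_eq_zero.1 this).resolve_left ht
    linarith [min_le_right (w t) (w s)]
  have hgap : ∑ t, M.T s a t * (w s - w t) = 0 := by
    simp_rw [mul_sub]
    rw [Finset.sum_sub_distrib, h.2 w hw, ← Finset.sum_mul, hsum]
    ring
  have hnonneg : ∀ t ∈ Finset.univ, 0 ≤ M.T s a t * (w s - w t) := fun t _ => by
    rcases eq_or_ne (M.T s a t) 0 with h0 | h0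
    · simp [h0]
    · exact mul_nonneg (M.T_nonneg s a t) (sub_nonneg.2 (hle t h0))
  have := (Finset.sum_eq_zero_iff_of_nonneg hnonneg).1 hgap s' (Finset.mem_univ s')
  linarith [(mul_eq_zero.1 this).resolve_left hT]

lemma IsTight.reward_eq_zero {M : MDP S A} {s : S} {a : A} (h : M.IsTight s a) {v : S → ℝ}
    (hv : ∀ s, 0 ≤ v s) (hfix : M.bellman v = v) {s' : S} (hT : M.T s a s' ≠ 0) :
    M.R s a s' = 0 := by
  have hle := (M.le_bellman v h.1).trans_eq (congrFun hfix s)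
  simp_rw [mul_add] at hle
  rw [Finset.sum_add_distrib, h.2 v (M.isSuperharmonic_of_bellman_eq hv hfix)] at hle
  have hnonneg : ∀ t ∈ Finset.univ, 0 ≤ M.T s a t * M.R s a t :=
    fun t _ => mul_nonneg (M.T_nonneg s a t) (M.R_nonneg s a t)
  have hzero := le_antisymm (by linarith) (Finset.sum_nonneg hnonneg)
  have := (Finset.sum_eq_zero_iff_of_nonneg hnonneg).1 hzero s' (Finset.mem_univ s')
  exact (mul_eq_zero.1 this).resolve_left hT

/-- Some superharmonic function is strict at every pair that is not tight. -/
lemma exists_isSuperharmonic_strict (M : MDP S A) :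
    ∃ w, M.IsSuperharmonic w ∧ (∀ s, 1 ≤ w s) ∧
      ∀ s a, M.enabled s a → ¬ M.IsTight s a → ∑ s', M.T s a s' * w s' < w s := by
  have hex : ∀ p : S × A, ∃ w, M.IsSuperharmonic w ∧
      (M.enabled p.1 p.2 → ¬ M.IsTight p.1 p.2 → ∑ s', M.T p.1 p.2 s' * w s' < w p.1) := by
    intro p
    by_cases hp : M.enabled p.1 p.2 ∧ ¬ M.IsTight p.1 p.2
    · obtain ⟨hen, hnt⟩ := hp
      simp only [IsTight, hen, true_and, not_forall] at hnt
      obtain ⟨w, hw, hne⟩ := hnt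
      exact ⟨w, hw, fun _ _ => lt_of_le_of_ne (hw.2 _ _ hen) hne⟩
    · exact ⟨0, M.isSuperharmonic_zero, fun h₁ h₂ => absurd ⟨h₁, h₂⟩ hp⟩
  choose w hw hstrict using hex
  have hsup := IsSuperharmonic.sum hw
  refine ⟨_, hsup.add_one, fun s => le_add_of_nonneg_left (hsup.1 s), fun s a ha hnt => ?_⟩
  have hsum : ∑ s', M.T s a s' = 1 := ha
  simp only [mul_add, mul_one, Finset.sum_add_distrib, hsum, add_lt_add_iff_right]
  simp_rw [Finset.mul_sum]
  rw [Finset.sum_comm]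
  exact Finset.sum_lt_sum (fun p _ => (hw p).2 s a ha)
    ⟨(s, a), Finset.mem_univ _, hstrict (s, a) ha hnt⟩

/-- If `M` has finite value, some function is eventually superharmonic and a supersolution of the
Bellman equation for all approximations of `M`. -/
lemma exists_eventually_supersolution (M : MDP S A) (Mn : ℕ → MDP S A)
    (hR : ∀ n, (Mn n).R = M.R)
    (hTconv : ∀ s a s', Tendsto (fun n => (Mn n).T s a s') atTop (𝓝 (M.T s a s')))
    (hzero : ∀ n s a s', M.T s a s' = 0 → (Mn n).T s a s' = 0)
    (hsum : ∀ n s a, (∑ s', (Mn n).T s a s') = ∑ s', M.T s a s')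
    (hfin : ∃ v : S → ℝ, (∀ s, 0 ≤ v s) ∧ M.bellman v = v) :
    ∃ w : S → ℝ, (∀ s, 1 ≤ w s) ∧ ∀ᶠ n in atTop, ∀ s a, (Mn n).enabled s a →
      ∑ s', (Mn n).T s a s' * w s' ≤ w s ∧
      ∑ s', (Mn n).T s a s' * ((Mn n).R s a s' + w s') ≤ w s := by
  obtain ⟨v, hv, hfix⟩ := hfin
  obtain ⟨w, hw, hw1, hstrict⟩ := M.exists_isSuperharmonic_strict
  have hscale : ∀ᶠ c : ℝ in atTop, ∀ s a, M.enabled s a → ¬ M.IsTight s a →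
      ∑ s', M.T s a s' * M.R s a s' < c * (w s - ∑ s', M.T s a s' * w s') := by
    simp only [eventually_all]
    intro s a ha hnt
    exact (tendsto_id.atTop_mul_const (sub_pos.2 (hstrict s a ha hnt))).eventually_gt_atTop _
  obtain ⟨c, hc, hc1⟩ := (hscale.and (eventually_ge_atTop 1)).exists
  refine ⟨fun s => c * w s, fun s => one_le_mul_of_one_le_of_one_le hc1 (hw1 s), ?_⟩
  simp only [eventually_all]
  intro s a
  by_cases ha : M.enabled s a
  swap
  · exact Eventually.of_forall fun n hn => absurd ((hsum n s a).symm.trans hn) ha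
  by_cases hnt : M.IsTight s a
  · refine Eventually.of_forall fun n hn => ?_
    have hn' : ∑ s', (Mn n).T s a s' = 1 := hn
    have hharm : ∑ s', (Mn n).T s a s' * (c * w s') = c * w s := by
      rw [← one_mul (c * w s), ← hn', Finset.sum_mul]
      refine Finset.sum_congr rfl fun s' _ => ?_
      by_cases h0 : M.T s a s' = 0
      · simp [hzero n s a s' h0]
      · rw [hnt.eq_of_ne_zero hw h0]
    refine ⟨hharm.le, le_of_eq ((Finset.sum_congr rfl fun s' _ => ?_).trans hharm)⟩
    by_cases h0 : M.T s a s' = 0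
    · simp [hzero n s a s' h0]
    · rw [hR, hnt.reward_eq_zero hv hfix h0, zero_add]
  · have hlim : Tendsto (fun n => ∑ s', (Mn n).T s a s' * (M.R s a s' + c * w s')) atTop
        (𝓝 (∑ s', M.T s a s' * (M.R s a s' + c * w s'))) :=
      tendsto_finsetSum _ fun s' _ => (hTconv s a s').mul_const _
    have hlt : ∑ s', M.T s a s' * (M.R s a s' + c * w s') < c * w s := by
      have hlt' := hc s a ha hnt
      simp_rw [mul_add, mul_left_comm _ c]
      rw [Finset.sum_add_distrib, ← Finset.mul_sum]
      linarith
    filter_upwards [hlim.eventually_lt_const hlt] with n hn _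
    rw [hR]
    refine ⟨le_trans (Finset.sum_le_sum fun s' _ => ?_) hn.le, hn.le⟩
    exact mul_le_mul_of_nonneg_left (le_add_of_nonneg_left (M.R_nonneg s a s'))
      ((Mn n).T_nonneg s a s')

lemma bellman_le_mul (M : MDP S A) {w u : S → ℝ} {c : ℝ} (hw : ∀ s, 0 ≤ w s) (hc : 1 ≤ c)
    (h : ∀ s a, M.enabled s a → ∑ s', M.T s a s' * w s' ≤ w s ∧
      ∑ s', M.T s a s' * (M.R s a s' + w s') ≤ w s)
    (hu : ∀ s, u s ≤ c * w s) (s : S) : M.bellman u s ≤ c * w s := by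
  refine M.bellman_le (mul_nonneg (by linarith) (hw s)) fun a ha => ?_
  obtain ⟨h₁, h₂⟩ := h s a ha
  calc ∑ s', M.T s a s' * (M.R s a s' + u s')
      ≤ ∑ s', M.T s a s' * (M.R s a s' + c * w s') :=
        Finset.sum_le_sum fun s' _ =>
          mul_le_mul_of_nonneg_left (by linarith [hu s']) (M.T_nonneg s a s')
    _ = ∑ s', M.T s a s' * (M.R s a s' + w s') + (c - 1) * ∑ s', M.T s a s' * w s' := by
        rw [Finset.mul_sum, ← Finset.sum_add_distrib]
        exact Finset.sum_congr rfl fun s' _ => by ring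
    _ ≤ w s + (c - 1) * w s :=
        add_le_add h₂ (mul_le_mul_of_nonneg_left h₁ (by linarith))
    _ = c * w s := by ring

end MDP

/-- for an MDP `M` with finite value and sampled approximations
`Mn` as above, the dampened Mann iteration over the approximated Bellman
operators (for any Mann scheme) is bounded. -/
theorem mdp_mann_iteration_bounded (S A : Type) [Fintype S] [Fintype A]
    (M : MDP S A) (Mn : ℕ → MDP S A)
    (hR : ∀ n, (Mn n).R = M.R)
    (hTconv : ∀ s a s', Tendsto (fun n => (Mn n).T s a s') atTop (nhds (M.T s a s')))
    (hzero : ∀ n s a s', M.T s a s' = 0 → (Mn n).T s a s' = 0)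
    (hsum : ∀ n s a, (∑ s', (Mn n).T s a s') = ∑ s', M.T s a s')
    (hfin : ∃ v : S → ℝ, (∀ s, 0 ≤ v s) ∧ M.bellman v = v)
    (α β : ℕ → ℝ) (hα : ∀ n, α n ∈ Set.Ico (0 : ℝ) 1) (hβ : ∀ n, β n ∈ Set.Ico (0 : ℝ) 1)
    (hβ0 : Tendsto β atTop (nhds 0)) (hβdiv : ¬ Summable β)
    (v0 : S → ℝ) (hv0 : ∀ s, 0 ≤ v0 s) :
    ∃ C : ℝ, ∀ n, ‖mannSeq α β (fun n => (Mn n).bellman) v0 n‖ ≤ C := by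
  set x := mannSeq α β (fun n => (Mn n).bellman) v0
  have hstep : ∀ n s, x (n + 1) s =
      (1 - β n) * (α n * x n s + (1 - α n) * (Mn n).bellman (x n) s) := fun _ _ => rfl
  have hnonneg : ∀ n s, 0 ≤ x n s := by
    intro n
    induction n with
    | zero => exact hv0
    | succ n ih =>
      intro s
      rw [hstep]
      exact mul_nonneg (sub_nonneg.2 (hβ n).2.le) (add_nonneg (mul_nonneg (hα n).1 (ih s))
        (mul_nonneg (sub_nonneg.2 (hα n).2.le) ((Mn n).bellman_nonneg _ s)))
  obtain ⟨w, hw1, hev⟩ := M.exists_eventually_supersolution Mn hR hTconv hzero hsum hfin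
  obtain ⟨N, hN⟩ := eventually_atTop.1 hev
  have hw0 : ∀ s, 0 ≤ w s := fun s => zero_le_one.trans (hw1 s)
  obtain ⟨c, hc1, hcN⟩ : ∃ c : ℝ, 1 ≤ c ∧ ‖x N‖ ≤ c :=
    ⟨max 1 ‖x N‖, le_max_left _ _, le_max_right _ _⟩
  have hle : ∀ n, N ≤ n → ∀ s, x n s ≤ c * w s := by
    intro n hn
    induction n, hn using Nat.le_induction with
    | base =>
      intro s
      calc x N s ≤ ‖x N‖ := (Real.le_norm_self _).trans (norm_le_pi_norm _ s)
        _ ≤ c := hcN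
        _ ≤ c * w s := le_mul_of_one_le_right (by linarith) (hw1 s)
    | succ n hn ih =>
      intro s
      have hcw : 0 ≤ c * w s := mul_nonneg (by linarith) (hw0 s)
      have hb := (Mn n).bellman_le_mul hw0 hc1 (hN n hn) ih s
      have hα1 : 0 ≤ 1 - α n := sub_nonneg.2 (hα n).2.le
      rw [hstep]
      calc (1 - β n) * (α n * x n s + (1 - α n) * (Mn n).bellman (x n) s)
          ≤ (1 - β n) * (α n * (c * w s) + (1 - α n) * (c * w s)) :=
            mul_le_mul_of_nonneg_left
              (add_le_add (mul_le_mul_of_nonneg_left (ih s) (hα n).1)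
                (mul_le_mul_of_nonneg_left hb hα1)) (sub_nonneg.2 (hβ n).2.le)
        _ = (1 - β n) * (c * w s) := by ring
        _ ≤ c * w s := mul_le_of_le_one_left hcw (by linarith [(hβ n).1])
  have hbdd : IsBoundedUnder (· ≤ ·) atTop fun n => ‖x n‖ := by
    refine isBoundedUnder_of_eventually_le (a := c * ‖w‖) ?_
    filter_upwards [eventually_ge_atTop N] with n hn
    refine (pi_norm_le_iff_of_nonneg (by positivity)).2 fun s => ?_
    rw [Real.norm_of_nonneg (hnonneg n s)]
    exact (hle n hn s).trans (mul_le_mul_of_nonneg_left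
      ((Real.le_norm_self _).trans (norm_le_pi_norm _ s)) (by linarith))
  obtain ⟨C, hC⟩ := hbdd.bddAbove_range
  exact ⟨C, fun n => hC ⟨n, rfl⟩⟩
end
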